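/- Let M be a small elementary submodel of 𝕄 and p(x) a type over M. Then p has a global extension q(x) such that for all tuples b ∈ 𝕄, if c ⊨ q restricted to Mb, then b ⫝^CK_M c; in particular, q is a global coheir extension of p (finitely satisfiable in M). -/

import Mathlib

/- Common model-theoretic infrastructure for formalizing
   "NSOP₂ theories are NSOP₁" (arXiv:2206.08512).

   We work with a monster model `𝕄` of a complete theory: a sufficiently
   saturated and strongly homogeneous `L`-structure.  Tuples are functions
   `α → 𝕄`; sets of formulas with parameters are coded via `FmlP`. -/

open FirstOrder Language

universe u v w

namespace NSOP2Paper

/-- A first-order formula in free variables `α ⊕ Fin n` together with an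
`n`-tuple of parameters from `𝕄`. -/
abbrev FmlP (L : FirstOrder.Language.{u, u}) (𝕄 : Type u) (α : Type v) :=
  Σ n : ℕ, L.Formula (α ⊕ Fin n) × (Fin n → 𝕄)

/-- `a ≡_C b` : the tuples `a` and `b` satisfy the same formulas with
parameters from `C`. -/
def EqTpOver (L : FirstOrder.Language.{u, u}) {𝕄 : Type u} [L.Structure 𝕄] (C : Set 𝕄)
    {α : Type v} (a b : α → 𝕄) : Prop :=
  ∀ (n : ℕ) (φ : L.Formula (α ⊕ Fin n)) (c : Fin n → 𝕄), (∀ i, c i ∈ C) →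
    (φ.Realize (Sum.elim a c) ↔ φ.Realize (Sum.elim b c))

/-- `tp(a / C)` is finitely satisfiable in `Ms`: every formula over `C`
satisfied by `a` has a realization by a tuple from `Ms`. -/
def FinSatIn (L : FirstOrder.Language.{u, u}) {𝕄 : Type u} [L.Structure 𝕄] (Ms : Set 𝕄)
    {α : Type v} (a : α → 𝕄) (C : Set 𝕄) : Prop :=
  ∀ (n : ℕ) (φ : L.Formula (α ⊕ Fin n)) (c : Fin n → 𝕄), (∀ i, c i ∈ C) →
    φ.Realize (Sum.elim a c) →
    ∃ m : α → 𝕄, (∀ i, m i ∈ Ms) ∧ φ.Realize (Sum.elim m c)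

/-- `Ms` is the underlying set of a (small) elementary submodel of `𝕄`. -/
def IsElemSubmodel (L : FirstOrder.Language.{u, u}) {𝕄 : Type u} [L.Structure 𝕄] (Ms : Set 𝕄) : Prop :=
  ∃ S : L.ElementarySubstructure 𝕄, (S : Set 𝕄) = Ms

/-- A complete consistent global type (a complete type over the monster `𝕄`)
in variables `α`, coded as the set of formulas-with-parameters it contains. -/
structure GlobalType (L : FirstOrder.Language.{u, u}) (𝕄 : Type u) [L.Structure 𝕄] (α : Type v) where
  carrier : Set (FmlP L 𝕄 α)
  consistent : ∀ t : Finset (FmlP L 𝕄 α), ↑t ⊆ carrier →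
    ∃ a : α → 𝕄, ∀ p ∈ t, p.2.1.Realize (Sum.elim a p.2.2)
  complete : ∀ (n : ℕ) (φ : L.Formula (α ⊕ Fin n)) (c : Fin n → 𝕄),
    (⟨n, (φ, c)⟩ : FmlP L 𝕄 α) ∈ carrier ∨ (⟨n, (φ.not, c)⟩ : FmlP L 𝕄 α) ∈ carrier

variable {L : FirstOrder.Language.{u, u}} {𝕄 : Type u} [L.Structure 𝕄]

/-- The global type `q` is finitely satisfiable in `Ms` (i.e. it is a coheir of
its restriction to `Ms`). -/
def GlobalType.FinSatInM {α : Type v} (q : GlobalType L 𝕄 α) (Ms : Set 𝕄) : Prop :=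
  ∀ t : Finset (FmlP L 𝕄 α), ↑t ⊆ q.carrier →
    ∃ m : α → 𝕄, (∀ i, m i ∈ Ms) ∧ ∀ p ∈ t, p.2.1.Realize (Sum.elim m p.2.2)

/-- `a ⊨ q|_C` : the tuple `a` realizes the restriction of the global type `q`
to parameters from `C`. -/
def RealizesType {α : Type v} (q : GlobalType L 𝕄 α) (a : α → 𝕄) (C : Set 𝕄) : Prop :=
  ∀ (n : ℕ) (φ : L.Formula (α ⊕ Fin n)) (c : Fin n → 𝕄), (∀ i, c i ∈ C) →
    (⟨n, (φ, c)⟩ : FmlP L 𝕄 α) ∈ q.carrier → φ.Realize (Sum.elim a c)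

/-- The global type `q` extends `tp(a / C)`. -/
def ExtendsTpOver {α : Type v} (q : GlobalType L 𝕄 α) (C : Set 𝕄) (a : α → 𝕄) : Prop :=
  ∀ (n : ℕ) (φ : L.Formula (α ⊕ Fin n)) (c : Fin n → 𝕄), (∀ i, c i ∈ C) →
    φ.Realize (Sum.elim a c) → (⟨n, (φ, c)⟩ : FmlP L 𝕄 α) ∈ q.carrier

/-- `B` is a coheir Morley sequence over `Ms` in the global type `q`:
`q` is finitely satisfiable in `Ms` and `B i ⊨ q|_(Ms ∪ B_{<i})`. -/
def MorleyIn {α : Type v} (q : GlobalType L 𝕄 α) (Ms : Set 𝕄) (B : ℕ → α → 𝕄) : Prop :=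
  q.FinSatInM Ms ∧
    ∀ i : ℕ, RealizesType q (B i) (Ms ∪ ⋃ (j : ℕ) (_ : j < i), Set.range (B j))

/-- `B` is a coheir Morley sequence over `Ms`. -/
def CoheirMorley (L : FirstOrder.Language.{u, u}) {𝕄 : Type u} [L.Structure 𝕄] (Ms : Set 𝕄)
    {α : Type v} (B : ℕ → α → 𝕄) : Prop :=
  ∃ q : GlobalType L 𝕄 α, MorleyIn q Ms B

/-- Flatten an `ℕ`-indexed sequence of `α`-tuples into a single tuple. -/
def flatSeq {α : Type v} (I : ℕ → α → 𝕄) : ℕ × α → 𝕄 := fun p => I p.1 p.2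

/-- The sequence `I` is indiscernible over `C`. -/
def IndiscernibleOver (L : FirstOrder.Language.{u, u}) {𝕄 : Type u} [L.Structure 𝕄] (C : Set 𝕄)
    {α : Type v} (I : ℕ → α → 𝕄) : Prop :=
  ∀ (n : ℕ) (f g : Fin n → ℕ), StrictMono f → StrictMono g →
    EqTpOver L C (fun p : Fin n × α => I (f p.1) p.2) (fun p : Fin n × α => I (g p.1) p.2)

/-- `𝕄` is `κ`-saturated: every finitely satisfiable set of formulas in fewer
than `κ` variables over a parameter set of size `< κ` is realized in `𝕄`. -/
def IsSaturated (L : FirstOrder.Language.{u, u}) (𝕄 : Type u) [L.Structure 𝕄] (κ : Cardinal.{u}) : Prop :=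
  ∀ (α : Type u) (A : Set 𝕄), Cardinal.mk α < κ → Cardinal.mk A < κ →
    ∀ Γ : Set (FmlP L 𝕄 α), (∀ p ∈ Γ, ∀ i, p.2.2 i ∈ A) →
      (∀ t : Finset (FmlP L 𝕄 α), ↑t ⊆ Γ →
        ∃ a : α → 𝕄, ∀ p ∈ t, p.2.1.Realize (Sum.elim a p.2.2)) →
      ∃ a : α → 𝕄, ∀ p ∈ Γ, p.2.1.Realize (Sum.elim a p.2.2)

/-- `𝕄` is strongly `κ`-homogeneous: partial elementary maps between tuples of
length `< κ` extend to automorphisms of `𝕄`. -/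
def IsStronglyHomogeneous (L : FirstOrder.Language.{u, u}) (𝕄 : Type u) [L.Structure 𝕄]
    (κ : Cardinal.{u}) : Prop :=
  ∀ (α : Type u), Cardinal.mk α < κ → ∀ a b : α → 𝕄, EqTpOver L (∅ : Set 𝕄) a b →
    ∃ σ : 𝕄 ≃[L] 𝕄, ∀ i, σ (a i) = b i

/-- `𝕄` is a monster model (for smallness degree `κ`): sufficiently saturated
and strongly homogeneous. -/
def IsMonster (L : FirstOrder.Language.{u, u}) (𝕄 : Type u) [L.Structure 𝕄] (κ : Cardinal.{u}) : Prop :=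
  Cardinal.aleph0 < κ ∧ IsSaturated L 𝕄 κ ∧ IsStronglyHomogeneous L 𝕄 κ

/-! ### Tree combinatorics -/

/-- The meet (longest common prefix) of two finite sequences. -/
def meet {A : Type w} [DecidableEq A] : List A → List A → List A
  | a :: as, b :: bs => if a = b then a :: meet as bs else []
  | _, _ => []

/-- The meet of `η 0, …, η i`. -/
def combMeet {A : Type w} [DecidableEq A] {k : ℕ} (η : Fin k → List A) (i : Fin k) : List A :=
  (List.ofFn fun j : Fin i.val => η (Fin.castLE i.2.le j)).foldl meet (η i)

/-- `η 0, …, η (k-1)` is a descending comb: a lexicographically increasing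
antichain such that the meet of `η 0, …, η (i+1)` is a proper initial segment
of the meet of `η 0, …, η i`. -/
def DescendingComb {A : Type w} [DecidableEq A] [LT A] {k : ℕ} (η : Fin k → List A) : Prop :=
  (∀ i j : Fin k, i ≠ j → ¬ η i <+: η j) ∧
  (∀ i j : Fin k, i < j → List.Lex (· < ·) (η i) (η j)) ∧
  (∀ (i : ℕ) (h : i + 1 < k),
    combMeet η ⟨i + 1, h⟩ <+: combMeet η ⟨i, by omega⟩ ∧
    combMeet η ⟨i + 1, h⟩ ≠ combMeet η ⟨i, by omega⟩)

/-! ### Tree properties of theories (witnessed in the monster model) -/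

/-- `T = Th(𝕄)` has `SOP₁`. -/
def HasSOP1 (L : FirstOrder.Language.{u, u}) (𝕄 : Type u) [L.Structure 𝕄] : Prop :=
  ∃ (k m : ℕ) (φ : L.Formula (Fin k ⊕ Fin m)) (b : List Bool → Fin m → 𝕄),
    (∀ σ : ℕ → Bool, ∃ a : Fin k → 𝕄,
      ∀ n : ℕ, φ.Realize (Sum.elim a (b (List.ofFn fun i : Fin n => σ i)))) ∧
    ∀ η₁ η₂ : List Bool, (η₁ ++ [false]) <+: η₂ →
      ¬ ∃ a : Fin k → 𝕄, φ.Realize (Sum.elim a (b η₂)) ∧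
        φ.Realize (Sum.elim a (b (η₁ ++ [true])))

/-- `T = Th(𝕄)` has `SOP₂`. -/
def HasSOP2 (L : FirstOrder.Language.{u, u}) (𝕄 : Type u) [L.Structure 𝕄] : Prop :=
  ∃ (k m : ℕ) (φ : L.Formula (Fin k ⊕ Fin m)) (b : List Bool → Fin m → 𝕄),
    (∀ σ : ℕ → Bool, ∃ a : Fin k → 𝕄,
      ∀ n : ℕ, φ.Realize (Sum.elim a (b (List.ofFn fun i : Fin n => σ i)))) ∧
    ∀ η₁ η₂ : List Bool, ¬ η₁ <+: η₂ → ¬ η₂ <+: η₁ →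
      ¬ ∃ a : Fin k → 𝕄, φ.Realize (Sum.elim a (b η₁)) ∧ φ.Realize (Sum.elim a (b η₂))

/-- `T = Th(𝕄)` has `k`-`DCTP₁`: paths are consistent but descending combs of
size `k` are inconsistent. -/
def HasKDCTP1 (L : FirstOrder.Language.{u, u}) (𝕄 : Type u) [L.Structure 𝕄] (k : ℕ) : Prop :=
  ∃ (r m : ℕ) (φ : L.Formula (Fin r ⊕ Fin m)) (b : List ℕ → Fin m → 𝕄),
    (∀ σ : ℕ → ℕ, ∃ a : Fin r → 𝕄,
      ∀ n : ℕ, φ.Realize (Sum.elim a (b (List.ofFn fun i : Fin n => σ i)))) ∧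
    ∀ η : Fin k → List ℕ, DescendingComb η →
      ¬ ∃ a : Fin r → 𝕄, ∀ i, φ.Realize (Sum.elim a (b (η i)))

/-- `T = Th(𝕄)` has weak `k`-`TP₁`: paths are consistent but any `k` pairwise
incomparable nodes with common pairwise meet are inconsistent. -/
def HasWeakKTP1 (L : FirstOrder.Language.{u, u}) (𝕄 : Type u) [L.Structure 𝕄] (k : ℕ) : Prop :=
  ∃ (r m : ℕ) (φ : L.Formula (Fin r ⊕ Fin m)) (b : List ℕ → Fin m → 𝕄),
    (∀ σ : ℕ → ℕ, ∃ a : Fin r → 𝕄,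
      ∀ n : ℕ, φ.Realize (Sum.elim a (b (List.ofFn fun i : Fin n => σ i)))) ∧
    ∀ η : Fin k → List ℕ,
      (∀ i j, i ≠ j → ¬ η i <+: η j) →
      (∀ i j i' j' : Fin k, i ≠ j → i' ≠ j' → meet (η i) (η j) = meet (η i') (η j')) →
      ¬ ∃ a : Fin r → 𝕄, ∀ i, φ.Realize (Sum.elim a (b (η i)))

/-- `T = Th(𝕄)` has `k`-`DCTP₂`: paths are `k`-inconsistent but descending
combs are consistent. -/
def HasKDCTP2 (L : FirstOrder.Language.{u, u}) (𝕄 : Type u) [L.Structure 𝕄] (k : ℕ) : Prop :=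
  ∃ (r m : ℕ) (φ : L.Formula (Fin r ⊕ Fin m)) (b : List Bool → Fin m → 𝕄),
    (∀ σ : ℕ → Bool, ∀ s : Finset ℕ, s.card = k →
      ¬ ∃ a : Fin r → 𝕄, ∀ n ∈ s,
        φ.Realize (Sum.elim a (b (List.ofFn fun i : Fin n => σ i)))) ∧
    ∀ (l : ℕ) (η : Fin l → List Bool), DescendingComb η →
      ∃ a : Fin r → 𝕄, ∀ i, φ.Realize (Sum.elim a (b (η i)))

/-! ### Kim-dividing and Conant-dividing, with respect to coheir Morley sequences -/

/-- `φ(x, b)` Kim-divides over `Ms`: some coheir Morley sequence over `Ms`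
starting with `b` makes it inconsistent. -/
def KimDivides (L : FirstOrder.Language.{u, u}) {𝕄 : Type u} [L.Structure 𝕄] (Ms : Set 𝕄)
    {α : Type v} {n : ℕ} (φ : L.Formula (α ⊕ Fin n)) (b : Fin n → 𝕄) : Prop :=
  ∃ B : ℕ → Fin n → 𝕄, CoheirMorley L Ms B ∧ B 0 = b ∧
    ¬ ∃ a : α → 𝕄, ∀ i, φ.Realize (Sum.elim a (B i))

/-- `φ(x, b)` Kim-forks over `Ms`: it implies a finite disjunction of formulas
Kim-dividing over `Ms`. -/
def KimForks (L : FirstOrder.Language.{u, u}) {𝕄 : Type u} [L.Structure 𝕄] (Ms : Set 𝕄)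
    {α : Type v} {n : ℕ} (φ : L.Formula (α ⊕ Fin n)) (b : Fin n → 𝕄) : Prop :=
  ∃ (N : ℕ) (m : Fin N → ℕ) (ψ : ∀ j : Fin N, L.Formula (α ⊕ Fin (m j)))
    (c : ∀ j : Fin N, Fin (m j) → 𝕄),
    (∀ j, KimDivides L Ms (ψ j) (c j)) ∧
    ∀ a : α → 𝕄, φ.Realize (Sum.elim a b) → ∃ j, (ψ j).Realize (Sum.elim a (c j))

/-- `φ(x, b)` Conant-divides over `Ms`: every coheir Morley sequence over `Ms`
starting with `b` makes it inconsistent. -/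
def ConantDivides (L : FirstOrder.Language.{u, u}) {𝕄 : Type u} [L.Structure 𝕄] (Ms : Set 𝕄)
    {α : Type v} {n : ℕ} (φ : L.Formula (α ⊕ Fin n)) (b : Fin n → 𝕄) : Prop :=
  ∀ B : ℕ → Fin n → 𝕄, CoheirMorley L Ms B → B 0 = b →
    ¬ ∃ a : α → 𝕄, ∀ i, φ.Realize (Sum.elim a (B i))

/-- `φ(x, b)` Conant-forks over `Ms`. -/
def ConantForks (L : FirstOrder.Language.{u, u}) {𝕄 : Type u} [L.Structure 𝕄] (Ms : Set 𝕄)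
    {α : Type v} {n : ℕ} (φ : L.Formula (α ⊕ Fin n)) (b : Fin n → 𝕄) : Prop :=
  ∃ (N : ℕ) (m : Fin N → ℕ) (ψ : ∀ j : Fin N, L.Formula (α ⊕ Fin (m j)))
    (c : ∀ j : Fin N, Fin (m j) → 𝕄),
    (∀ j, ConantDivides L Ms (ψ j) (c j)) ∧
    ∀ a : α → 𝕄, φ.Realize (Sum.elim a b) → ∃ j, (ψ j).Realize (Sum.elim a (c j))

/-- `a ⫝^{K*}_{Ms} b` : `tp(a/Ms b)` contains no formula Conant-forking
over `Ms`. -/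
def ConantIndep (L : FirstOrder.Language.{u, u}) {𝕄 : Type u} [L.Structure 𝕄] (Ms : Set 𝕄)
    {α : Type v} {β : Type w} (a : α → 𝕄) (b : β → 𝕄) : Prop :=
  ∀ (n : ℕ) (φ : L.Formula (α ⊕ Fin n)) (d : Fin n → 𝕄),
    (∀ i, d i ∈ Ms ∪ Set.range b) → φ.Realize (Sum.elim a d) →
    ¬ ConantForks L Ms φ d

/-! ### Abstract independence relations between sets over models -/

/-- An abstract ternary relation `A ⫝_M B` between subsets of `𝕄` over
(elementary submodels of) `𝕄`. -/
structure IndRel (L : FirstOrder.Language.{u, u}) (𝕄 : Type u) [L.Structure 𝕄] where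
  rel : Set 𝕄 → Set 𝕄 → Set 𝕄 → Prop

/-- A set `S` of `α`-tuples is type-definable over `C`. -/
def TypeDefinableOver (L : FirstOrder.Language.{u, u}) {𝕄 : Type u} [L.Structure 𝕄] (C : Set 𝕄)
    {γ : Type v} (S : Set (γ → 𝕄)) : Prop :=
  ∃ Γ : Set (FmlP L 𝕄 γ), (∀ p ∈ Γ, ∀ i, p.2.2 i ∈ C) ∧
    ∀ g : γ → 𝕄, g ∈ S ↔ ∀ p ∈ Γ, p.2.1.Realize (Sum.elim g p.2.2)

namespace IndRel


/-- Invariance under automorphisms of `𝕄`. -/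
def Invariant (R : IndRel L 𝕄) : Prop :=
  ∀ (σ : 𝕄 ≃[L] 𝕄) (A Ms B : Set 𝕄), R.rel A Ms B →
    R.rel ((⇑σ) '' A) ((⇑σ) '' Ms) ((⇑σ) '' B)

/-- Monotonicity (on both sides). -/
def Mono (R : IndRel L 𝕄) : Prop :=
  ∀ (A A' Ms B B' : Set 𝕄), IsElemSubmodel L Ms → R.rel A Ms B →
    Ms ⊆ A' → A' ⊆ A → Ms ⊆ B' → B' ⊆ B → R.rel A' Ms B'

/-- Existence: for `M ⊆ A, B` there is `A' ≡_M A` with `A' ⫝_M B`. -/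
def Existence (R : IndRel L 𝕄) (κ : Cardinal.{u}) : Prop :=
  ∀ (Ms : Set 𝕄), IsElemSubmodel L Ms → Cardinal.mk Ms < κ →
    ∀ (α β : Type u), Cardinal.mk α < κ → Cardinal.mk β < κ →
      ∀ (a : α → 𝕄) (b : β → 𝕄),
        ∃ a' : α → 𝕄, EqTpOver L Ms a' a ∧
          R.rel (Ms ∪ Set.range a') Ms (Ms ∪ Set.range b)

/-- Right extension. -/
def RightExt (R : IndRel L 𝕄) (κ : Cardinal.{u}) : Prop :=
  ∀ (Ms : Set 𝕄), IsElemSubmodel L Ms → Cardinal.mk Ms < κ →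
    ∀ (α : Type u), Cardinal.mk α < κ → ∀ (a : α → 𝕄) (B C : Set 𝕄),
      Cardinal.mk B < κ → Cardinal.mk C < κ →
      R.rel (Set.range a) Ms B → B ⊆ C →
      ∃ a' : α → 𝕄, EqTpOver L B a' a ∧ R.rel (Set.range a') Ms C

/-- Quasi-strong finite character: for complete types `p = tp(a₀/Ms)` and
`q = tp(b₀/Ms)`, the set of pairs of realizations `(a, b)` with `a ⫝_Ms b`
is type-definable over `Ms`. -/
def QSFC (R : IndRel L 𝕄) (κ : Cardinal.{u}) : Prop :=
  ∀ (Ms : Set 𝕄), IsElemSubmodel L Ms → Cardinal.mk Ms < κ →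
    ∀ (α β : Type u), Cardinal.mk α < κ → Cardinal.mk β < κ →
      ∀ (a₀ : α → 𝕄) (b₀ : β → 𝕄),
        TypeDefinableOver L Ms {g : (α ⊕ β) → 𝕄 |
          EqTpOver L Ms (g ∘ Sum.inl) a₀ ∧ EqTpOver L Ms (g ∘ Sum.inr) b₀ ∧
          R.rel (Set.range (g ∘ Sum.inl)) Ms (Set.range (g ∘ Sum.inr))}

/-- The coheir chain condition. -/
def CoheirChain (R : IndRel L 𝕄) (κ : Cardinal.{u}) : Prop :=
  ∀ (Ms : Set 𝕄), IsElemSubmodel L Ms → Cardinal.mk Ms < κ →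
    ∀ (α β : Type u), Cardinal.mk α < κ → Cardinal.mk β < κ →
      ∀ (a : α → 𝕄) (b : β → 𝕄), R.rel (Set.range a) Ms (Set.range b) →
        ∀ I : ℕ → β → 𝕄, CoheirMorley L Ms I → I 0 = b →
          ∃ I' : ℕ → β → 𝕄, EqTpOver L Ms (flatSeq I') (flatSeq I) ∧
            R.rel (Set.range a) Ms (⋃ i, Set.range (I' i)) ∧
            ∀ i, EqTpOver L (Ms ∪ Set.range a) (I' i) b

/-- `R` implies `⫝ʰ` : `A ⫝_M B` implies `tp(B / M A)` is finitely
satisfiable in `M`. -/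
def StrongerThanH (R : IndRel L 𝕄) : Prop :=
  ∀ (A Ms B : Set 𝕄), IsElemSubmodel L Ms → R.rel A Ms B →
    FinSatIn L Ms (fun x : B => (x : 𝕄)) (Ms ∪ A)

end IndRel

/-- The axioms satisfied by the relations among which `⫝^CK` is weakest. -/
def GoodRel (R : IndRel L 𝕄) (κ : Cardinal.{u}) : Prop :=
  R.StrongerThanH ∧ R.Invariant ∧ R.Mono ∧ R.Existence κ ∧ R.RightExt κ ∧ R.CoheirChain κ

/-- `R` is `⫝^CK` : the weakest relation implying `⫝ʰ` and satisfying
invariance, monotonicity, existence, right extension and the coheir chain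
condition. -/
def IsCK (R : IndRel L 𝕄) (κ : Cardinal.{u}) : Prop :=
  GoodRel R κ ∧ ∀ R' : IndRel L 𝕄, GoodRel R' κ →
    ∀ A Ms B : Set 𝕄, R'.rel A Ms B → R.rel A Ms B

/-- `q` is a canonical global type over `Ms` (w.r.t. the relation `R = ⫝^CK`):
whenever `c ⊨ q|_{Ms b}` we have `b ⫝^CK_{Ms} c`. -/
def IsCanonicalGlobal (R : IndRel L 𝕄) (κ : Cardinal.{u}) (Ms : Set 𝕄) {α : Type v}
    (q : GlobalType L 𝕄 α) : Prop :=
  ∀ (β : Type u), Cardinal.mk β < κ → ∀ (b : β → 𝕄) (c : α → 𝕄),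
    RealizesType q c (Ms ∪ Set.range b) → R.rel (Set.range b) Ms (Set.range c)

/-- A canonical Morley sequence over `Ms`: a coheir Morley sequence in a
canonical coheir. -/
def CanonicalMorley (R : IndRel L 𝕄) (κ : Cardinal.{u}) (Ms : Set 𝕄) {α : Type v}
    (I : ℕ → α → 𝕄) : Prop :=
  ∃ q : GlobalType L 𝕄 α, IsCanonicalGlobal R κ Ms q ∧ MorleyIn q Ms I

/-- `q` is a strong canonical global type over `Ms`. -/
def IsStrongCanonical (R : IndRel L 𝕄) (κ : Cardinal.{u}) (Ms : Set 𝕄) {α : Type v}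
    (q : GlobalType L 𝕄 α) : Prop :=
  ∀ (β : Type u), Cardinal.mk β < κ → ∀ (b : β → 𝕄) (c : α → 𝕄),
    RealizesType q c (Ms ∪ Set.range b) →
    ∀ (γ : Type u), Cardinal.mk γ < κ → ∀ (a : γ → 𝕄),
      ∃ a' : γ → 𝕄, EqTpOver L (Ms ∪ Set.range c) a' a ∧
        ∃ q' : GlobalType L 𝕄 (γ ⊕ α), IsCanonicalGlobal R κ Ms q' ∧
          ExtendsTpOver q' (Ms ∪ Set.range b) (Sum.elim a' c)

/-! ### `M`-invariant ideals and `𝓘`-Kim-dividing -/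

/-- An `Ms`-invariant ideal on the definable subsets of `𝕄` (in variables `α`). -/
structure InvIdeal (L : FirstOrder.Language.{u, u}) (𝕄 : Type u) [L.Structure 𝕄] (Ms : Set 𝕄)
    (α : Type v) where
  mem : Set (α → 𝕄) → Prop
  definable_of_mem : ∀ S, mem S → ∃ (n : ℕ) (ψ : L.Formula (α ⊕ Fin n)) (c : Fin n → 𝕄),
    S = {a : α → 𝕄 | ψ.Realize (Sum.elim a c)}
  union_mem : ∀ S T, mem S → mem T → mem (S ∪ T)
  subset_mem : ∀ S T, mem S →
    (∃ (n : ℕ) (ψ : L.Formula (α ⊕ Fin n)) (c : Fin n → 𝕄),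
      T = {a : α → 𝕄 | ψ.Realize (Sum.elim a c)}) →
    T ⊆ S → mem T
  invariant : ∀ σ : 𝕄 ≃[L] 𝕄, (∀ x ∈ Ms, σ x = x) → ∀ S, mem S →
    mem ((fun a => (⇑σ) ∘ a) '' S)

/-- `φ(x, b)` `𝓘`-Kim-divides over `Ms`. -/
def IKimDivides {Ms : Set 𝕄} {α : Type v} (I : InvIdeal L 𝕄 Ms α) {n : ℕ}
    (φ : L.Formula (α ⊕ Fin n)) (b : Fin n → 𝕄) : Prop :=
  ∃ (B : ℕ → Fin n → 𝕄) (k : ℕ), CoheirMorley L Ms B ∧ B 0 = b ∧ 0 < k ∧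
    ∀ s : Finset ℕ, s.card = k →
      I.mem {a : α → 𝕄 | ∀ i ∈ s, φ.Realize (Sum.elim a (B i))}

/-- `φ(x, b)` `𝓘`-Kim-forks over `Ms`. -/
def IKimForks {Ms : Set 𝕄} {α : Type v} (I : InvIdeal L 𝕄 Ms α) {n : ℕ}
    (φ : L.Formula (α ⊕ Fin n)) (b : Fin n → 𝕄) : Prop :=
  ∃ (N : ℕ) (m : Fin N → ℕ) (ψ : ∀ j : Fin N, L.Formula (α ⊕ Fin (m j)))
    (c : ∀ j : Fin N, Fin (m j) → 𝕄),
    (∀ j, IKimDivides I (ψ j) (c j)) ∧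
    ∀ a : α → 𝕄, φ.Realize (Sum.elim a b) → ∃ j, (ψ j).Realize (Sum.elim a (c j))

/-- `φ(x, b)` `𝓘`-quasi-divides over `Ms`. -/
def IQuasiDivides {Ms : Set 𝕄} {α : Type v} (I : InvIdeal L 𝕄 Ms α) {n : ℕ}
    (φ : L.Formula (α ⊕ Fin n)) (b : Fin n → 𝕄) : Prop :=
  ∃ (mm : ℕ) (b' : Fin mm → Fin n → 𝕄), 0 < mm ∧ (∀ j, EqTpOver L Ms (b' j) b) ∧
    I.mem {a : α → 𝕄 | ∀ j, φ.Realize (Sum.elim a (b' j))}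

/-! ### `h^⫝`-inconsistency and the derived relation `⫝'` -/

/-- A family of formulas is `h^⫝`-inconsistent with respect to `P = tp(a₀/Ms)`. -/
def HInconsistent (R : IndRel L 𝕄) (Ms : Set 𝕄) {α : Type v} (a₀ : α → 𝕄)
    {ι : Type w} (m : ι → ℕ) (φ : ∀ i : ι, L.Formula (α ⊕ Fin (m i)))
    (b : ∀ i : ι, Fin (m i) → 𝕄) : Prop :=
  ¬ ∃ a : α → 𝕄, EqTpOver L Ms a a₀ ∧
      R.rel (Set.range a) Ms (⋃ i, Set.range (b i)) ∧
      ∀ i, (φ i).Realize (Sum.elim a (b i))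

/-- A single formula is `h^⫝`-inconsistent with respect to `P = tp(a₀/Ms)`. -/
def HInconsistentSingle (R : IndRel L 𝕄) (Ms : Set 𝕄) {α : Type v} (a₀ : α → 𝕄)
    {n : ℕ} (φ : L.Formula (α ⊕ Fin n)) (b : Fin n → 𝕄) : Prop :=
  ¬ ∃ a : α → 𝕄, EqTpOver L Ms a a₀ ∧ R.rel (Set.range a) Ms (Set.range b) ∧
      φ.Realize (Sum.elim a b)

/-- `φ(x, b)` `h^⫝`-Kim-divides with respect to `tp(a₀/Ms)`. -/
def HKimDivides (R : IndRel L 𝕄) (Ms : Set 𝕄) {α : Type v} (a₀ : α → 𝕄)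
    {n : ℕ} (φ : L.Formula (α ⊕ Fin n)) (b : Fin n → 𝕄) : Prop :=
  ∃ B : ℕ → Fin n → 𝕄, CoheirMorley L Ms B ∧ B 0 = b ∧
    HInconsistent R Ms a₀ (fun _ : ℕ => n) (fun _ => φ) B

/-- `φ(x, b)` `h^⫝`-Kim-forks with respect to `tp(a₀/Ms)`. -/
def HKimForks (R : IndRel L 𝕄) (Ms : Set 𝕄) {α : Type v} (a₀ : α → 𝕄)
    {n : ℕ} (φ : L.Formula (α ⊕ Fin n)) (b : Fin n → 𝕄) : Prop :=
  ∃ (N : ℕ) (m : Fin N → ℕ) (ψ : ∀ j : Fin N, L.Formula (α ⊕ Fin (m j)))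
    (c : ∀ j : Fin N, Fin (m j) → 𝕄),
    (∀ j, HKimDivides R Ms a₀ (ψ j) (c j)) ∧
    ∀ a : α → 𝕄, φ.Realize (Sum.elim a b) → ∃ j, (ψ j).Realize (Sum.elim a (c j))

/-- `φ(x, b)` `h^⫝`-quasi-divides with respect to `tp(a₀/Ms)`. -/
def HQuasiDivides (R : IndRel L 𝕄) (Ms : Set 𝕄) {α : Type v} (a₀ : α → 𝕄)
    {n : ℕ} (φ : L.Formula (α ⊕ Fin n)) (b : Fin n → 𝕄) : Prop :=
  ∃ (mm : ℕ) (b' : Fin mm → Fin n → 𝕄), 0 < mm ∧ (∀ j, EqTpOver L Ms (b' j) b) ∧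
    HInconsistent R Ms a₀ (fun _ : Fin mm => n) (fun _ => φ) b'

/-- The derived relation `⫝'` on tuples:
`tp(a / Ms b)` contains no formula `h^⫝`-Kim-forking w.r.t. `tp(a/Ms)`. -/
def DerivedIndep (R : IndRel L 𝕄) (Ms : Set 𝕄) {α : Type v} {β : Type w}
    (a : α → 𝕄) (b : β → 𝕄) : Prop :=
  ∀ (n : ℕ) (φ : L.Formula (α ⊕ Fin n)) (d : Fin n → 𝕄),
    (∀ i, d i ∈ Ms ∪ Set.range b) → φ.Realize (Sum.elim a d) →
    ¬ HKimForks R Ms a φ d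

/-- The derived relation `⫝'` as a relation between sets over models. -/
def derived (R : IndRel L 𝕄) : IndRel L 𝕄 where
  rel A Ms B := ∀ (n : ℕ) (φ : L.Formula (↥A ⊕ Fin n)) (d : Fin n → 𝕄),
    (∀ i, d i ∈ Ms ∪ B) → φ.Realize (Sum.elim (fun x : A => (x : 𝕄)) d) →
    ¬ HKimForks R Ms (fun x : A => (x : 𝕄)) φ d

/-! ### Coheir trees -/

/-- The tuple, indexed by extensions, consisting of the part of the tree `c`
lying (weakly) above the node `ν` (where `ν` has length `Lh`). -/
def subtreeTupleLen {α : Type v} {n : ℕ} (c : {l : List ℕ // l.length ≤ n} → α → 𝕄)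
    (Lh : ℕ) (ν : List ℕ) (hν : ν.length = Lh) :
    ({s : List ℕ // Lh + s.length ≤ n} × α) → 𝕄 :=
  fun p => c ⟨ν ++ p.1.1, by rw [List.length_append, hν]; exact p.1.2⟩ p.2

end NSOP2Paper

namespace NSOP2Paper

section Definability

variable {L : FirstOrder.Language.{u, u}} {𝕄 : Type u} [L.Structure 𝕄]

theorem definable_setOf_realize {α : Type v} {ι : Type w} {C : Set 𝕄} (φ : L.Formula (α ⊕ ι))
    (c : ι → 𝕄) (hc : ∀ i, c i ∈ C) : C.Definable L {x | φ.Realize (Sum.elim x c)} := by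
  rw [Set.definable_iff_exists_formula_sum]
  refine ⟨φ.relabel (Sum.elim Sum.inr fun i => Sum.inl ⟨c i, hc i⟩), ?_⟩
  ext x
  simp only [Set.mem_ofPred_eq, Formula.realize_relabel]
  apply iff_of_eq
  congr 1
  ext (i | i) <;> rfl

theorem exists_fmlP_of_definable {α : Type v} {C : Set 𝕄} {S : Set (α → 𝕄)}
    (h : C.Definable L S) :
    ∃ p : FmlP L 𝕄 α, (∀ i, p.2.2 i ∈ C) ∧ S = {x | p.2.1.Realize (Sum.elim x p.2.2)} := by
  classical
  obtain ⟨A₀, hA₀, hS⟩ := Set.definable_iff_finitely_definable.1 h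
  obtain ⟨φ, rfl⟩ := Set.definable_iff_exists_formula_sum.1 hS
  let e : (A₀ : Set 𝕄) ≃ Fin A₀.card := A₀.equivFin
  refine ⟨⟨A₀.card, φ.relabel (Sum.elim (Sum.inr ∘ e) Sum.inl), fun i => (e.symm i : 𝕄)⟩,
    fun i => hA₀ (e.symm i).2, ?_⟩
  ext x
  simp only [Set.mem_ofPred_eq, Formula.realize_relabel]
  apply iff_of_eq
  congr 1
  ext (i | i) <;> simp

theorem definable_section {α : Type v} {β : Type w} {C D : Set 𝕄} {S : Set (α ⊕ β → 𝕄)}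
    (h : C.Definable L S) (b : β → 𝕄) (hCD : C ⊆ D) (hb : ∀ i, b i ∈ D) :
    D.Definable L {x | Sum.elim x b ∈ S} := by
  obtain ⟨φ, rfl⟩ := Set.definable_iff_exists_formula_sum.1 h
  rw [Set.definable_iff_exists_formula_sum]
  refine ⟨φ.relabel (Sum.elim (fun m : C => Sum.inl ⟨m, hCD m.2⟩)
    (Sum.elim Sum.inr fun i => Sum.inl ⟨b i, hb i⟩)), ?_⟩
  ext x
  simp only [Set.mem_ofPred_eq, Formula.realize_relabel]
  apply iff_of_eq
  congr 1
  ext (i | i | i) <;> rfl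

theorem definable_section_left {α : Type v} {β : Type w} {C D : Set 𝕄} {S : Set (α ⊕ β → 𝕄)}
    (h : C.Definable L S) (a : α → 𝕄) (hCD : C ⊆ D) (ha : ∀ i, a i ∈ D) :
    D.Definable L {y | Sum.elim a y ∈ S} := by
  have := definable_section (h.preimage_comp Sum.swap) a hCD ha
  simpa using this

theorem exists_section_of_definable {α : Type v} {β : Type w} {C : Set 𝕄} {b : β → 𝕄}
    {S : Set (α → 𝕄)} (h : (C ∪ Set.range b).Definable L S) :
    ∃ S' : Set (α ⊕ β → 𝕄), C.Definable L S' ∧ ∀ x, x ∈ S ↔ Sum.elim x b ∈ S' := by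
  classical
  obtain ⟨φ, rfl⟩ := Set.definable_iff_exists_formula_sum.1 h
  have hmem (c : ↥(C ∪ Set.range b)) : ∃ z : C ⊕ β, (c : 𝕄) = Sum.elim (↑) b z := by
    rcases c.2 with hc | ⟨i, hi⟩
    · exact ⟨Sum.inl ⟨c, hc⟩, rfl⟩
    · exact ⟨Sum.inr i, hi.symm⟩
  choose z hz using hmem
  refine ⟨_, Set.definable_iff_exists_formula_sum.2 ⟨φ.relabel
    (Sum.elim (fun c => Sum.map id Sum.inr (z c)) (Sum.inr ∘ Sum.inl)), rfl⟩, fun x => ?_⟩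
  simp only [Set.mem_ofPred_eq, Formula.realize_relabel]
  apply iff_of_eq
  congr 1
  ext (i | i)
  · rw [Sum.elim_inl, hz i, Function.comp_apply, Sum.elim_inl]
    cases z i <;> rfl
  · rfl

theorem exists_section_left_of_definable {α : Type v} {β : Type w} {C : Set 𝕄} {a : α → 𝕄}
    {S : Set (β → 𝕄)} (h : (C ∪ Set.range a).Definable L S) :
    ∃ S' : Set (α ⊕ β → 𝕄), C.Definable L S' ∧ ∀ y, y ∈ S ↔ Sum.elim a y ∈ S' := by
  obtain ⟨S', hS', h'⟩ := exists_section_of_definable h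
  exact ⟨_, hS'.preimage_comp Sum.swap, fun y => by simp [h']⟩

theorem definable_comp_equiv {α : Type v} {C D : Set 𝕄} {S : Set (α → 𝕄)} (h : D.Definable L S)
    (σ : 𝕄 ≃[L] 𝕄) (hσ : ∀ d ∈ D, ∃ c ∈ C, σ c = d) : C.Definable L {x | σ ∘ x ∈ S} := by
  obtain ⟨φ, rfl⟩ := Set.definable_iff_exists_formula_sum.1 h
  rw [Set.definable_iff_exists_formula_sum]
  choose f hf hfσ using hσ
  refine ⟨φ.relabel (Sum.map (fun d : D => ⟨f d d.2, hf d d.2⟩) id), ?_⟩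
  ext x
  simp only [Set.mem_ofPred_eq, Formula.realize_relabel]
  refine (iff_of_eq ?_).trans (StrongHomClass.realize_formula σ φ)
  congr 1
  ext (i | i)
  · simp [hfσ]
  · rfl

theorem definable_setOf_apply_eq {α : Type v} {C : Set 𝕄} (i : α) {m : 𝕄} (hm : m ∈ C) :
    C.Definable L {x : α → 𝕄 | x i = m} := by
  have := definable_setOf_realize (L := L) (α := α) (C := C)
    ((Term.var (Sum.inl i)).equal (Term.var (Sum.inr ()))) (fun _ : Unit => m) (fun _ => hm)
  simpa using this

theorem eqTpOver_iff {α : Type v} {C : Set 𝕄} {a b : α → 𝕄} :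
    EqTpOver L C a b ↔ ∀ S, C.Definable L S → (a ∈ S ↔ b ∈ S) := by
  constructor
  · intro h S hS
    obtain ⟨p, hp, rfl⟩ := exists_fmlP_of_definable hS
    exact h _ _ _ hp
  · intro h n φ c hc
    exact h _ (definable_setOf_realize φ c hc)

theorem eqTpOver_of_imp {α : Type v} {C : Set 𝕄} {a b : α → 𝕄}
    (h : ∀ S, C.Definable L S → a ∈ S → b ∈ S) : EqTpOver L C a b :=
  eqTpOver_iff.2 fun S hS => ⟨h S hS, fun hb => by_contra fun ha => h _ hS.compl ha hb⟩

theorem finSatIn_iff {α : Type v} {Ms C : Set 𝕄} {a : α → 𝕄} :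
    FinSatIn L Ms a C ↔
      ∀ S, C.Definable L S → a ∈ S → ∃ m : α → 𝕄, (∀ i, m i ∈ Ms) ∧ m ∈ S := by
  constructor
  · intro h S hS ha
    obtain ⟨p, hp, rfl⟩ := exists_fmlP_of_definable hS
    exact h _ _ _ hp ha
  · intro h n φ c hc ha
    exact h _ (definable_setOf_realize φ c hc) ha

namespace EqTpOver

variable {α : Type v} {β : Type w} {C D : Set 𝕄} {a b c : α → 𝕄}

theorem refl (C : Set 𝕄) (a : α → 𝕄) : EqTpOver L C a a := fun _ _ _ _ => Iff.rfl

theorem symm (h : EqTpOver L C a b) : EqTpOver L C b a := fun n φ c hc => (h n φ c hc).symm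

theorem trans (h : EqTpOver L C a b) (h' : EqTpOver L C b c) : EqTpOver L C a c :=
  fun n φ d hd => (h n φ d hd).trans (h' n φ d hd)

theorem mono (h : EqTpOver L C a b) (hD : D ⊆ C) : EqTpOver L D a b :=
  fun n φ d hd => h n φ d fun i => hD (hd i)

theorem comp (h : EqTpOver L C a b) (f : β → α) : EqTpOver L C (a ∘ f) (b ∘ f) :=
  eqTpOver_iff.2 fun _ hS => eqTpOver_iff.1 h _ (hS.preimage_comp f)

theorem equiv_comp (h : EqTpOver L C a b) (σ : 𝕄 ≃[L] 𝕄) (hσ : ∀ d ∈ D, ∃ c ∈ C, σ c = d) :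
    EqTpOver L D (σ ∘ a) (σ ∘ b) :=
  eqTpOver_iff.2 fun _ hS => eqTpOver_iff.1 h _ (definable_comp_equiv hS σ hσ)

theorem equiv_comp_self (σ : 𝕄 ≃[L] 𝕄) (hσ : ∀ d ∈ C, σ d = d) (a : α → 𝕄) :
    EqTpOver L C (σ ∘ a) a := by
  intro n φ c hc
  rw [← StrongHomClass.realize_formula σ (v := Sum.elim a c), Sum.comp_elim]
  have : σ ∘ c = c := funext fun i => hσ _ (hc i)
  rw [this]

theorem apply_eq (h : EqTpOver L C a b) (i : α) (hi : b i ∈ C) : a i = b i :=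
  (eqTpOver_iff.1 h _ (definable_setOf_apply_eq i hi)).2 rfl

end EqTpOver

theorem exists_mem_of_finite_inter {κ : Cardinal.{u}} (hsat : IsSaturated L 𝕄 κ) {α : Type u}
    (hα : Cardinal.mk α < κ) {A : Set 𝕄} (hA : Cardinal.mk A < κ) (F : Set (Set (α → 𝕄)))
    (hF : ∀ S ∈ F, A.Definable L S) (hfin : ∀ t : Finset (Set (α → 𝕄)), ↑t ⊆ F →
      ∃ x : α → 𝕄, ∀ S ∈ t, x ∈ S) : ∃ x : α → 𝕄, ∀ S ∈ F, x ∈ S := by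
  classical
  let ext (p : FmlP L 𝕄 α) : Set (α → 𝕄) := {x | p.2.1.Realize (Sum.elim x p.2.2)}
  obtain ⟨x, hx⟩ := hsat α A hα hA {p | (∀ i, p.2.2 i ∈ A) ∧ ext p ∈ F} (fun p hp => hp.1)
    fun t ht => by
      obtain ⟨x, hx⟩ := hfin (t.image ext) (by
        rw [Finset.coe_image]
        rintro _ ⟨p, hp, rfl⟩
        exact (ht hp).2)
      exact ⟨x, fun p hp => hx _ (Finset.mem_image_of_mem _ hp)⟩
  refine ⟨x, fun S hS => ?_⟩
  obtain ⟨p, hp, hSp⟩ := exists_fmlP_of_definable (hF S hS)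
  rw [hSp]
  exact hx p ⟨hp, by rwa [hSp] at hS⟩

theorem EqTpOver.exists_equiv {κ : Cardinal.{u}} (hM : IsMonster L 𝕄 κ) {C : Set 𝕄}
    (hC : Cardinal.mk C < κ) {α : Type u} (hα : Cardinal.mk α < κ) {a b : α → 𝕄}
    (h : EqTpOver L C a b) : ∃ σ : 𝕄 ≃[L] 𝕄, (∀ c ∈ C, σ c = c) ∧ σ ∘ a = b := by
  have hcard : Cardinal.mk (α ⊕ C) < κ := by
    rw [Cardinal.mk_sum, Cardinal.lift_id, Cardinal.lift_id]
    exact Cardinal.add_lt_of_lt hM.1.le hα hC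
  obtain ⟨σ, hσ⟩ := hM.2.2 (α ⊕ C) hcard (Sum.elim a (↑)) (Sum.elim b (↑)) <| eqTpOver_iff.2
    fun S hS => eqTpOver_iff.1 h _
      (definable_section hS (fun c : C => (c : 𝕄)) (Set.empty_subset C) fun c => c.2)
  exact ⟨σ, fun c hc => hσ (Sum.inr ⟨c, hc⟩), funext fun i => hσ (Sum.inl i)⟩

end Definability

section Closure

variable {L : FirstOrder.Language.{u, u}} {𝕄 : Type u} [L.Structure 𝕄]

/-- Over `Ms`, the type of `(a, b)` is a limit of types of `R`-independent pairs with the same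
marginal types as `a` and `b`. -/
def LimitIndep (R : IndRel L 𝕄) (Ms : Set 𝕄) {α : Type v} {β : Type w} (a : α → 𝕄) (b : β → 𝕄) :
    Prop :=
  ∀ S : Set (α ⊕ β → 𝕄), Ms.Definable L S → Sum.elim a b ∈ S →
    ∃ (a' : α → 𝕄) (b' : β → 𝕄), EqTpOver L Ms a' a ∧ EqTpOver L Ms b' b ∧
      Sum.elim a' b' ∈ S ∧ R.rel (Ms ∪ Set.range a') Ms (Ms ∪ Set.range b')

/-- The closure of `R`, for small sets, in the topology of types over the base. -/
def IndRel.closure (R : IndRel L 𝕄) (κ : Cardinal.{u}) : IndRel L 𝕄 where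
  rel A Ms B := Cardinal.mk A < κ ∧ Cardinal.mk Ms < κ ∧ Cardinal.mk B < κ ∧
    LimitIndep R Ms (fun x : A => (x : 𝕄)) (fun x : B => (x : 𝕄))

variable {R : IndRel L 𝕄} {κ : Cardinal.{u}} {Ms : Set 𝕄} {α β γ δ : Type u}
  {a : α → 𝕄} {b : β → 𝕄}

theorem image_union_range_of_fixed {σ : 𝕄 ≃[L] 𝕄} (hσ : ∀ m ∈ Ms, σ m = m) (a : α → 𝕄) :
    σ '' (Ms ∪ Set.range a) = Ms ∪ Set.range (σ ∘ a) := by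
  rw [Set.image_union, ← Set.range_comp, Set.image_congr hσ, Set.image_id']

theorem IndRel.Invariant.rel_of_fixed (hR : R.Invariant) {σ : 𝕄 ≃[L] 𝕄} (hσ : ∀ m ∈ Ms, σ m = m)
    (h : R.rel (Ms ∪ Set.range a) Ms (Ms ∪ Set.range b)) :
    R.rel (Ms ∪ Set.range (σ ∘ a)) Ms (Ms ∪ Set.range (σ ∘ b)) := by
  have := hR σ _ _ _ h
  rwa [image_union_range_of_fixed hσ, image_union_range_of_fixed hσ, Set.image_congr hσ,
    Set.image_id'] at this

theorem elim_comp_mem_of_fixed {σ : 𝕄 ≃[L] 𝕄} (hσ : ∀ m ∈ Ms, σ m = m) {S : Set (α → 𝕄)}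
    (hS : Ms.Definable L S) {x : α → 𝕄} (hx : x ∈ S) : σ ∘ x ∈ S :=
  (eqTpOver_iff.1 (EqTpOver.equiv_comp_self σ hσ x) S hS).2 hx

theorem LimitIndep.of_rel (h : R.rel (Ms ∪ Set.range a) Ms (Ms ∪ Set.range b)) :
    LimitIndep R Ms a b :=
  fun _ _ hab => ⟨a, b, EqTpOver.refl _ _, EqTpOver.refl _ _, hab, h⟩

theorem LimitIndep.comp (h : LimitIndep R Ms a b) (f : γ → α) (g : δ → β)
    (hR : ∀ (a' : α → 𝕄) (b' : β → 𝕄), R.rel (Ms ∪ Set.range a') Ms (Ms ∪ Set.range b') →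
      R.rel (Ms ∪ Set.range (a' ∘ f)) Ms (Ms ∪ Set.range (b' ∘ g))) :
    LimitIndep R Ms (a ∘ f) (b ∘ g) := by
  intro S hS hab
  obtain ⟨a₁, b₁, ha₁, hb₁, hab₁, h₁⟩ := h _ (hS.preimage_comp (Sum.map f g)) (by
    rwa [Set.mem_preimage, Sum.elim_comp_map])
  rw [Set.mem_preimage, Sum.elim_comp_map] at hab₁
  exact ⟨a₁ ∘ f, b₁ ∘ g, ha₁.comp f, hb₁.comp g, hab₁, hR _ _ h₁⟩

theorem LimitIndep.of_range_subset (hR : R.Mono) (hMs : IsElemSubmodel L Ms)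
    (h : LimitIndep R Ms a b) {a' : γ → 𝕄} {b' : δ → 𝕄} (ha : Set.range a' ⊆ Set.range a)
    (hb : Set.range b' ⊆ Set.range b) : LimitIndep R Ms a' b' := by
  obtain ⟨f, rfl⟩ := Set.range_subset_range_iff_exists_comp.1 ha
  obtain ⟨g, rfl⟩ := Set.range_subset_range_iff_exists_comp.1 hb
  exact h.comp f g fun a₁ b₁ h₁ => hR _ _ _ _ _ hMs h₁
    Set.subset_union_left (Set.union_subset_union_right _ (Set.range_comp_subset_range f a₁))
    Set.subset_union_left (Set.union_subset_union_right _ (Set.range_comp_subset_range g b₁))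

theorem LimitIndep.equiv_comp (hR : R.Invariant) (h : LimitIndep R Ms a b) (σ : 𝕄 ≃[L] 𝕄) :
    LimitIndep R (σ '' Ms) (σ ∘ a) (σ ∘ b) := by
  intro S hS hab
  obtain ⟨a', b', ha', hb', hab', h'⟩ := h _ (definable_comp_equiv hS σ fun _ hd => hd) (by
    rwa [Set.mem_ofPred_eq, Sum.comp_elim])
  refine ⟨σ ∘ a', σ ∘ b', ha'.equiv_comp σ fun _ hd => hd, hb'.equiv_comp σ fun _ hd => hd, ?_, ?_⟩
  · rwa [Set.mem_ofPred_eq, Sum.comp_elim] at hab'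
  · simpa only [Set.image_union, Set.range_comp] using hR σ _ _ _ h'

theorem LimitIndep.exists_right (hM : IsMonster L 𝕄 κ) (hR : R.Invariant)
    (hMs : Cardinal.mk Ms < κ) (hα : Cardinal.mk α < κ) (h : LimitIndep R Ms a b)
    {S : Set (α ⊕ β → 𝕄)} (hS : Ms.Definable L S) (hab : Sum.elim a b ∈ S) :
    ∃ b' : β → 𝕄, EqTpOver L Ms b' b ∧ Sum.elim a b' ∈ S ∧
      R.rel (Ms ∪ Set.range a) Ms (Ms ∪ Set.range b') := by
  obtain ⟨a₁, b₁, ha₁, hb₁, hab₁, h₁⟩ := h S hS hab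
  obtain ⟨σ, hσ, rfl⟩ := ha₁.exists_equiv hM hMs hα
  refine ⟨σ ∘ b₁, (EqTpOver.equiv_comp_self σ hσ b₁).trans hb₁, ?_, hR.rel_of_fixed hσ h₁⟩
  rw [← Sum.comp_elim]
  exact elim_comp_mem_of_fixed hσ hS hab₁

theorem LimitIndep.exists_left (hM : IsMonster L 𝕄 κ) (hR : R.Invariant)
    (hMs : Cardinal.mk Ms < κ) (hβ : Cardinal.mk β < κ) (h : LimitIndep R Ms a b)
    {S : Set (α ⊕ β → 𝕄)} (hS : Ms.Definable L S) (hab : Sum.elim a b ∈ S) :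
    ∃ a' : α → 𝕄, EqTpOver L Ms a' a ∧ Sum.elim a' b ∈ S ∧
      R.rel (Ms ∪ Set.range a') Ms (Ms ∪ Set.range b) := by
  obtain ⟨a₁, b₁, ha₁, hb₁, hab₁, h₁⟩ := h S hS hab
  obtain ⟨σ, hσ, rfl⟩ := hb₁.exists_equiv hM hMs hβ
  refine ⟨σ ∘ a₁, (EqTpOver.equiv_comp_self σ hσ a₁).trans ha₁, ?_, hR.rel_of_fixed hσ h₁⟩
  rw [← Sum.comp_elim]
  exact elim_comp_mem_of_fixed hσ hS hab₁

theorem mk_union_lt (hκ : Cardinal.aleph0 ≤ κ) {A B : Set 𝕄} (hA : Cardinal.mk A < κ)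
    (hB : Cardinal.mk B < κ) : Cardinal.mk ↥(A ∪ B) < κ :=
  (Cardinal.mk_union_le A B).trans_lt (Cardinal.add_lt_of_lt hκ hA hB)

theorem mk_sum_lt (hκ : Cardinal.aleph0 ≤ κ) (hα : Cardinal.mk α < κ) (hβ : Cardinal.mk β < κ) :
    Cardinal.mk (α ⊕ β) < κ := by
  rw [Cardinal.mk_sum, Cardinal.lift_id, Cardinal.lift_id]
  exact Cardinal.add_lt_of_lt hκ hα hβ

theorem mk_range_lt (hα : Cardinal.mk α < κ) (a : α → 𝕄) : Cardinal.mk (Set.range a) < κ :=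
  Cardinal.mk_range_le.trans_lt hα

theorem closure_rel_of_limitIndep (hR : R.Mono) (hMs : IsElemSubmodel L Ms)
    (hMsκ : Cardinal.mk Ms < κ) (hα : Cardinal.mk α < κ) (hβ : Cardinal.mk β < κ)
    (h : LimitIndep R Ms a b) {A B : Set 𝕄} (hA : A = Set.range a) (hB : B = Set.range b) :
    (R.closure κ).rel A Ms B := by
  subst hA hB
  exact ⟨mk_range_lt hα a, hMsκ, mk_range_lt hβ b,
    h.of_range_subset hR hMs (by rw [Subtype.range_coe]) (by rw [Subtype.range_coe])⟩

theorem limitIndep_of_closure_rel (hR : R.Mono) (hMs : IsElemSubmodel L Ms) {A B : Set 𝕄}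
    (h : (R.closure κ).rel A Ms B) (hA : Set.range a ⊆ A) (hB : Set.range b ⊆ B) :
    LimitIndep R Ms a b :=
  h.2.2.2.of_range_subset hR hMs (by rwa [Subtype.range_coe]) (by rwa [Subtype.range_coe])

theorem exists_definable_subset_inter {C : Set 𝕄} (a : α → 𝕄) (t : Finset (Set (α → 𝕄))) :
    ∃ S₀ : Set (α → 𝕄), C.Definable L S₀ ∧ a ∈ S₀ ∧
      ∀ S ∈ t, C.Definable L S → a ∈ S → S₀ ⊆ S := by
  classical
  let f (S : Set (α → 𝕄)) := if C.Definable L S ∧ a ∈ S then S else Set.univ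
  refine ⟨⋂ S ∈ t, f S, Set.definable_biInter_finset (fun S => ?_) t, ?_, fun S hS hd ha => ?_⟩
  · by_cases h : C.Definable L S ∧ a ∈ S
    · simp [f, h]
    · simp [f, h]
  · simp only [Set.mem_iInter, f]
    intro S _
    split_ifs with h
    exacts [h.2, Set.mem_univ a]
  · refine (Set.biInter_subset_of_mem hS).trans ?_
    simp [f, hd, ha]

theorem range_eq_union_of_eqTpOver {C : Set 𝕄} (hC : Ms ⊆ C) {x : Ms ⊕ α → 𝕄}
    (h : EqTpOver L C x (Sum.elim (↑) a)) : Set.range x = Ms ∪ Set.range (x ∘ Sum.inr) := by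
  have hx : x ∘ Sum.inl = Subtype.val := funext fun m => h.apply_eq (Sum.inl m) (hC m.2)
  rw [← Sum.elim_comp_inl_inr x, Set.Sum.elim_range, hx, Subtype.range_coe, Sum.elim_comp_inr]

theorem closure_strongerThanH (hM : IsMonster L 𝕄 κ) (hH : R.StrongerThanH) (hI : R.Invariant) :
    (R.closure κ).StrongerThanH := by
  rintro A Ms B hMs ⟨hA, hMsκ, hB, h⟩
  rw [finSatIn_iff]
  intro S hS hBS
  rw [← Subtype.range_coe (s := A)] at hS
  obtain ⟨S', hS', hSS'⟩ := exists_section_left_of_definable hS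
  obtain ⟨b', -, hb'S, hb'⟩ := h.exists_right hM hI hMsκ hA hS' ((hSS' _).1 hBS)
  let f (i : B) : ↥(Ms ∪ Set.range b') := ⟨b' i, Or.inr ⟨i, rfl⟩⟩
  obtain ⟨m, hm, hmS⟩ := finSatIn_iff.1 (hH _ _ _ hMs hb') _
    ((hS.mono (Set.union_subset_union_right _ Set.subset_union_right)).preimage_comp f)
    ((hSS' _).2 hb'S)
  exact ⟨m ∘ f, fun i => hm _, hmS⟩

theorem closure_invariant (hI : R.Invariant) : (R.closure κ).Invariant := by
  rintro σ A Ms B ⟨hA, hMs, hB, h⟩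
  refine ⟨Cardinal.mk_image_le.trans_lt hA, Cardinal.mk_image_le.trans_lt hMs,
    Cardinal.mk_image_le.trans_lt hB, ?_⟩
  let fA := Equiv.Set.image σ A σ.injective
  let fB := Equiv.Set.image σ B σ.injective
  have := (h.equiv_comp hI σ).comp fA.symm fB.symm fun a' b' h' => by
    rwa [fA.symm.surjective.range_comp, fB.symm.surjective.range_comp]
  convert! this using 1
  · ext x
    exact congrArg Subtype.val (fA.apply_symm_apply x).symm
  · ext x
    exact congrArg Subtype.val (fB.apply_symm_apply x).symm

theorem closure_mono (hR : R.Mono) : (R.closure κ).Mono := by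
  rintro A A' Ms B B' hMs h - hA - hB
  refine ⟨(Cardinal.mk_le_mk_of_subset hA).trans_lt h.1, h.2.1,
    (Cardinal.mk_le_mk_of_subset hB).trans_lt h.2.2.1,
    limitIndep_of_closure_rel hR hMs h (by rwa [Subtype.range_coe]) (by rwa [Subtype.range_coe])⟩

theorem closure_existence (hκ : Cardinal.aleph0 ≤ κ) (hE : R.Existence κ) :
    (R.closure κ).Existence κ := by
  intro Ms hMs hMsκ α β hα hβ a b
  obtain ⟨a', ha', h⟩ := hE Ms hMs hMsκ α β hα hβ a b
  refine ⟨a', ha', mk_union_lt hκ hMsκ (mk_range_lt hα a'), hMsκ,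
    mk_union_lt hκ hMsκ (mk_range_lt hβ b), LimitIndep.of_rel ?_⟩
  simpa only [Subtype.range_coe, ← Set.union_assoc, Set.union_self] using h

theorem closure_rightExt (hM : IsMonster L 𝕄 κ) (hI : R.Invariant) (hR : R.Mono)
    (hE : R.RightExt κ) : (R.closure κ).RightExt κ := by
  intro Ms hMs hMsκ α hα a B C hB hC hrel hBC
  have hκ := hM.1.le
  let vB (x : B) : 𝕄 := x
  let vC (x : C) : 𝕄 := x
  have hvB : Set.range vB = B := Subtype.range_coe
  have hvC : Set.range vC = C := Subtype.range_coe
  have hW : LimitIndep R Ms a vB := limitIndep_of_closure_rel hR hMs hrel subset_rfl hvB.le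
  let bad : Set (Set (α ⊕ C → 𝕄)) := {S | Ms.Definable L S ∧ ∀ x : α → 𝕄, EqTpOver L Ms x a →
    R.rel (Ms ∪ Set.range x) Ms (Ms ∪ C) → Sum.elim x vC ∉ S}
  obtain ⟨a', ha'⟩ := exists_mem_of_finite_inter hM.2.1 hα (mk_union_lt hκ hMsκ hC)
    ({S | (Ms ∪ B).Definable L S ∧ a ∈ S} ∪ (fun S => {x | Sum.elim x vC ∉ S}) '' bad) (by
      rintro _ (⟨hS, -⟩ | ⟨S, ⟨hS, -⟩, rfl⟩)
      · exact hS.mono (Set.union_subset_union_right _ hBC)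
      · exact (definable_section hS vC Set.subset_union_left fun x => Or.inr x.2).compl) (by
      intro t ht
      obtain ⟨S₀, hS₀, haS₀, hS₀t⟩ := exists_definable_subset_inter (L := L) (C := Ms ∪ B) a t
      rw [← hvB] at hS₀
      obtain ⟨S', hS', hSS'⟩ := exists_section_of_definable hS₀
      obtain ⟨a₁, ha₁, ha₁S, h₁⟩ := hW.exists_left hM hI hMsκ hB hS' ((hSS' _).1 haS₀)
      obtain ⟨a₂, ha₂, h₂⟩ := hE Ms hMs hMsκ (Ms ⊕ α) (mk_sum_lt hκ hMsκ hα) (Sum.elim (↑) a₁)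
        (Ms ∪ B) (Ms ∪ C) (mk_union_lt hκ hMsκ hB) (mk_union_lt hκ hMsκ hC)
        (by simpa [hvB] using h₁) (Set.union_subset_union_right _ hBC)
      have hrange : Set.range a₂ = Ms ∪ Set.range (a₂ ∘ Sum.inr) :=
        range_eq_union_of_eqTpOver Set.subset_union_left ha₂
      rw [hrange] at h₂
      refine ⟨a₂ ∘ Sum.inr, fun S hS => ?_⟩
      rcases ht hS with h | ⟨S, ⟨-, h⟩, rfl⟩
      · exact hS₀t S hS h.1 h.2 ((eqTpOver_iff.1 (ha₂.comp Sum.inr) _ (by rwa [hvB] at hS₀)).2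
          ((hSS' _).2 ha₁S))
      · exact h _ (((ha₂.comp Sum.inr).mono Set.subset_union_left).trans ha₁) h₂)
  have haa' : EqTpOver L (Ms ∪ B) a a' := eqTpOver_of_imp fun S hS h => ha' S (Or.inl ⟨hS, h⟩)
  refine ⟨a', (haa'.mono Set.subset_union_right).symm,
    closure_rel_of_limitIndep hR hMs hMsκ hα hC (b := vC) ?_ rfl hvC.symm⟩
  intro S hS haS
  by_contra hcon
  refine ha' _ (Or.inr ⟨S, ⟨hS, fun x hx hrel hxS => hcon ⟨x, vC, ?_, EqTpOver.refl _ _, hxS, ?_⟩⟩,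
    rfl⟩) haS
  · exact hx.trans (haa'.mono Set.subset_union_left)
  · rwa [hvC]

theorem CoheirMorley.elim_base {I : ℕ → β → 𝕄} (h : CoheirMorley L Ms I) :
    CoheirMorley L Ms fun n => Sum.elim (fun m : Ms => (m : 𝕄)) (I n) := by
  classical
  obtain ⟨q, hfin, hI⟩ := h
  let v (m : Ms) : 𝕄 := m
  let C : Set (FmlP L 𝕄 (Ms ⊕ β)) := {p | ∃ p' ∈ q.carrier, ∀ x : β → 𝕄,
    p'.2.1.Realize (Sum.elim x p'.2.2) → p.2.1.Realize (Sum.elim (Sum.elim v x) p.2.2)}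
  have hC (t : Finset (FmlP L 𝕄 (Ms ⊕ β))) (ht : ↑t ⊆ C) :
      ∃ t' : Finset (FmlP L 𝕄 β), ↑t' ⊆ q.carrier ∧ ∀ x : β → 𝕄,
        (∀ p' ∈ t', p'.2.1.Realize (Sum.elim x p'.2.2)) →
        ∀ p ∈ t, p.2.1.Realize (Sum.elim (Sum.elim v x) p.2.2) := by
    have : ∀ p ∈ C, ∃ p' ∈ q.carrier, ∀ x : β → 𝕄, p'.2.1.Realize (Sum.elim x p'.2.2) →
      p.2.1.Realize (Sum.elim (Sum.elim v x) p.2.2) := fun p hp => hp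
    have : Inhabited (FmlP L 𝕄 β) := ⟨⟨0, ⊥, Fin.elim0⟩⟩
    choose! f hf hfp using ‹∀ p ∈ C, _›
    refine ⟨t.image f, ?_, fun x hx p hp => hfp p (ht hp) x (hx _ (Finset.mem_image_of_mem f hp))⟩
    rw [Finset.coe_image]
    rintro _ ⟨p, hp, rfl⟩
    exact hf p (ht hp)
  have hdec {D : Set 𝕄} (hD : Ms ⊆ D) (p : FmlP L 𝕄 (Ms ⊕ β)) (hp : ∀ i, p.2.2 i ∈ D) :
      ∃ p' : FmlP L 𝕄 β, (∀ i, p'.2.2 i ∈ D) ∧ ∀ x : β → 𝕄,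
        p'.2.1.Realize (Sum.elim x p'.2.2) ↔ p.2.1.Realize (Sum.elim (Sum.elim v x) p.2.2) := by
    obtain ⟨p', hp', hpp'⟩ := exists_fmlP_of_definable
      (definable_section_left (definable_setOf_realize p.2.1 p.2.2 hp) v subset_rfl
        fun m => hD m.2)
    exact ⟨p', hp', fun x => (Set.ext_iff.1 hpp' x).symm⟩
  refine ⟨⟨C, fun t ht => ?_, fun n φ c => ?_⟩, fun t ht => ?_, fun i n φ c hc hφ => ?_⟩
  · obtain ⟨t', ht', h⟩ := hC t ht
    obtain ⟨x, hx⟩ := q.consistent t' ht'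
    exact ⟨_, h x hx⟩
  · obtain ⟨⟨k, ψ, d⟩, -, hp'⟩ := hdec (Set.subset_univ Ms) ⟨n, φ, c⟩ fun _ => Set.mem_univ _
    refine (q.complete k ψ d).imp (fun h => ⟨_, h, fun x => (hp' x).1⟩) fun h => ⟨_, h, fun x => ?_⟩
    simpa only [Formula.realize_not] using mt (hp' x).2
  · obtain ⟨t', ht', h⟩ := hC t ht
    obtain ⟨m, hm, hmt⟩ := hfin t' ht'
    exact ⟨Sum.elim v m, Sum.forall.2 ⟨fun m => m.2, hm⟩, h m hmt⟩
  · obtain ⟨⟨k, ψ, d⟩, hd, hp'⟩ := hdec Set.subset_union_left ⟨n, φ, c⟩ hc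
    obtain ⟨p₁, hp₁, hp₁φ⟩ := hφ
    have hψ : (⟨k, ψ, d⟩ : FmlP L 𝕄 β) ∈ q.carrier := by
      refine (q.complete k ψ d).resolve_right fun hnot => ?_
      obtain ⟨x, hx⟩ := q.consistent {p₁, ⟨k, ψ.not, d⟩} (by
        simp [Set.insert_subset_iff, hp₁, hnot])
      have h₁ := hx p₁ (by simp)
      have h₂ := hx ⟨k, ψ.not, d⟩ (by simp)
      exact h₂ ((hp' x).2 (hp₁φ x h₁))
    refine (hp' _).1 (hI i k ψ d (fun j => ?_) hψ)
    have hdj := hd j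
    simp only [Set.mem_union, Set.mem_iUnion, Set.Sum.elim_range, Subtype.range_coe] at hdj ⊢
    tauto

theorem closure_coheirChain (hM : IsMonster L 𝕄 κ) (hI : R.Invariant) (hR : R.Mono)
    (hCh : R.CoheirChain κ) : (R.closure κ).CoheirChain κ := by
  classical
  intro Ms hMs hMsκ α β hα hβ a b hrel I hIM hI0
  have hκ := hM.1.le
  have hW : LimitIndep R Ms a b := limitIndep_of_closure_rel hR hMs hrel subset_rfl subset_rfl
  have hNβ : Cardinal.mk (ℕ × β) < κ := by
    rw [Cardinal.mk_prod, Cardinal.mk_nat, Cardinal.lift_aleph0, Cardinal.lift_uzero]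
    exact Cardinal.mul_lt_of_lt hκ hM.1 hβ
  let bad : Set (Set (α ⊕ (ℕ × β) → 𝕄)) := {S | Ms.Definable L S ∧ ∀ X : ℕ × β → 𝕄,
    EqTpOver L Ms X (flatSeq I) → R.rel (Ms ∪ Set.range a) Ms (Ms ∪ Set.range X) →
      Sum.elim a X ∉ S}
  let F₁ : Set (Set (ℕ × β → 𝕄)) := {S | Ms.Definable L S ∧ flatSeq I ∈ S}
  let F₂ : Set (Set (ℕ × β → 𝕄)) := {S | ∃ (n : ℕ) (T : Set (β → 𝕄)),
    (Ms ∪ Set.range a).Definable L T ∧ b ∈ T ∧ S = (fun X => X ∘ Prod.mk n) ⁻¹' T}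
  let F₃ : Set (Set (ℕ × β → 𝕄)) := (fun S => {X | Sum.elim a X ∉ S}) '' bad
  obtain ⟨X, hX⟩ := exists_mem_of_finite_inter (κ := κ) hM.2.1 (α := ℕ × β) hNβ
    (mk_union_lt hκ hMsκ (mk_range_lt hα a)) (F₁ ∪ F₂ ∪ F₃) (by
      rintro _ ((⟨hS, -⟩ | ⟨n, T, hT, -, rfl⟩) | ⟨S, ⟨hS, -⟩, rfl⟩)
      · exact hS.mono Set.subset_union_left
      · exact hT.preimage_comp _
      · exact (definable_section_left hS a Set.subset_union_left
          fun i => Set.mem_union_right _ (Set.mem_range_self i)).compl) (by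
      intro t ht
      have hF₂ : ∀ S ∈ F₂, ∃ (n : ℕ) (T : Set (β → 𝕄)), (Ms ∪ Set.range a).Definable L T ∧
        b ∈ T ∧ S = (fun X => X ∘ Prod.mk n) ⁻¹' T := fun S hS => hS
      choose! n T hT hbT hST using hF₂
      obtain ⟨T₀, hT₀, hbT₀, hT₀t⟩ :=
        exists_definable_subset_inter (L := L) (C := Ms ∪ Set.range a) b (t.image T)
      obtain ⟨S', hS', hTS'⟩ := exists_section_left_of_definable hT₀
      obtain ⟨a₁, ha₁, ha₁S, h₁⟩ := hW.exists_left hM hI hMsκ hβ hS' ((hTS' _).1 hbT₀)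
      have hr : Set.range (Sum.elim (fun m : Ms => (m : 𝕄)) a₁) = Ms ∪ Set.range a₁ := by
        simp
      obtain ⟨J, hJI, hJ, hJb⟩ := hCh Ms hMs hMsκ (Ms ⊕ α) (Ms ⊕ β) (mk_sum_lt hκ hMsκ hα)
        (mk_sum_lt hκ hMsκ hβ) (Sum.elim (↑) a₁) (Sum.elim (↑) b) (by simpa using h₁) _
        hIM.elim_base (by simp [hI0])
      obtain ⟨σ, hσ, hσa⟩ := ha₁.exists_equiv hM hMsκ hα
      let Y : ℕ × β → 𝕄 := fun p => J p.1 (Sum.inr p.2)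
      have hYI : EqTpOver L Ms Y (flatSeq I) :=
        hJI.comp fun p : ℕ × β => (p.1, (Sum.inr p.2 : Ms ⊕ β))
      have hYR : R.rel (Ms ∪ Set.range a₁) Ms (Ms ∪ Set.range Y) := by
        rw [hr] at hJ
        convert! hJ using 1
        have (i : ℕ) := range_eq_union_of_eqTpOver Set.subset_union_left (hJb i)
        simp only [this, ← Set.union_iUnion]
        congr 1
        ext y
        simp [Y]
      refine ⟨σ ∘ Y, fun S hS => ?_⟩
      rcases ht hS with (h | h) | ⟨S, ⟨-, h⟩, rfl⟩
      · exact elim_comp_mem_of_fixed hσ h.1 ((eqTpOver_iff.1 hYI _ h.1).2 h.2)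
      · rw [hST S h]
        refine hT₀t _ (Finset.mem_image_of_mem T hS) (hT S h) (hbT S h) ((hTS' _).2 ?_)
        have hY : EqTpOver L (Ms ∪ Set.range a₁) (Y ∘ Prod.mk (n S)) b :=
          ((hJb (n S)).comp Sum.inr).mono (Set.union_subset_union_right _ (by simp))
        have := (eqTpOver_iff.1 hY _ (definable_section_left hS' a₁ Set.subset_union_left
          fun i => Or.inr ⟨i, rfl⟩)).2 ha₁S
        have := elim_comp_mem_of_fixed hσ hS' this
        rwa [Sum.comp_elim, hσa] at this
      · refine h _ ((EqTpOver.equiv_comp_self σ hσ Y).trans hYI) ?_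
        rw [← hσa]
        exact hI.rel_of_fixed hσ hYR)
  have hXI : EqTpOver L Ms X (flatSeq I) :=
    (eqTpOver_of_imp fun S hS h => hX S (Or.inl (Or.inl ⟨hS, h⟩))).symm
  refine ⟨fun n i => X (n, i), hXI, closure_rel_of_limitIndep hR hMs hMsκ hα hNβ (b := X) ?_ rfl ?_,
    fun n => (eqTpOver_of_imp fun T hT h =>
      hX ((fun X => X ∘ Prod.mk n) ⁻¹' T) (Or.inl (Or.inr ⟨n, T, hT, h, rfl⟩))).symm⟩
  · intro S hS haS
    by_contra hcon
    exact hX _ (Or.inr ⟨S, ⟨hS, fun Y hY hrel hYS => hcon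
      ⟨a, Y, EqTpOver.refl _ _, hY.trans hXI.symm, hYS, hrel⟩⟩, rfl⟩) haS
  · ext y
    simp

theorem GoodRel.closure (hM : IsMonster L 𝕄 κ) (h : GoodRel R κ) : GoodRel (R.closure κ) κ :=
  let ⟨hH, hI, hR, hE, hX, hC⟩ := h
  ⟨closure_strongerThanH hM hH hI, closure_invariant hI, closure_mono hR,
    closure_existence hM.1.le hE, closure_rightExt hM hI hR hX, closure_coheirChain hM hI hR hC⟩

end Closure

section UltrafilterType

variable {L : FirstOrder.Language.{u, u}} {𝕄 : Type u} [L.Structure 𝕄]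

/-- The global type of the formulas that hold almost everywhere along an ultrafilter. -/
def GlobalType.ofUltrafilter (L : FirstOrder.Language.{u, u}) [L.Structure 𝕄] {α : Type v}
    (U : Ultrafilter (α → 𝕄)) : GlobalType L 𝕄 α where
  carrier := {p | ∀ᶠ x in (U : Filter (α → 𝕄)), p.2.1.Realize (Sum.elim x p.2.2)}
  consistent t ht := ((Filter.eventually_all_finset t).2 fun _ hp => ht hp).exists
  complete n φ c := by
    simp only [Set.mem_ofPred_eq, Formula.realize_not]
    exact U.em _

theorem eventually_of_realizesType_ofUltrafilter {α : Type v} {U : Ultrafilter (α → 𝕄)} {C : Set 𝕄}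
    {c : α → 𝕄} (hc : RealizesType (GlobalType.ofUltrafilter L U) c C) {S : Set (α → 𝕄)}
    (hS : C.Definable L S) (hcS : c ∈ S) : ∀ᶠ x in (U : Filter (α → 𝕄)), x ∈ S := by
  obtain ⟨⟨n, φ, d⟩, hd, rfl⟩ := exists_fmlP_of_definable hS
  refine ((GlobalType.ofUltrafilter L U).complete n φ d).resolve_right fun hnot => ?_
  exact hc n φ.not d hd hnot hcS

end UltrafilterType

section Realizations

variable {L : FirstOrder.Language.{u, u}} {𝕄 : Type u} [L.Structure 𝕄]

/-- Along some ultrafilter, almost all tuples are realizations of `tp(b₀/Ms)` independent from any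
given small set. -/
theorem exists_ultrafilter_indepRealizations {R : IndRel L 𝕄} {κ : Cardinal.{u}} {Ms : Set 𝕄}
    (hM : IsMonster L 𝕄 κ) (hI : R.Invariant) (hR : R.Mono) (hE : R.Existence κ)
    (hMs : IsElemSubmodel L Ms) (hMsκ : Cardinal.mk Ms < κ) {α : Type u}
    (hα : Cardinal.mk α < κ) (b₀ : α → 𝕄) :
    ∃ U : Ultrafilter (α → 𝕄), ∀ B : Set 𝕄, Cardinal.mk B < κ →
      ∀ᶠ c in (U : Filter (α → 𝕄)), EqTpOver L Ms c b₀ ∧ R.rel (Ms ∪ B) Ms (Ms ∪ Set.range c) := by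
  let G (B : {B : Set 𝕄 // Cardinal.mk B < κ}) : Set (α → 𝕄) :=
    {c | EqTpOver L Ms c b₀ ∧ R.rel (Ms ∪ B) Ms (Ms ∪ Set.range c)}
  have hne (B) : (G B).Nonempty := by
    obtain ⟨b', hb', h⟩ := hE Ms hMs hMsκ B.1 α B.2 hα (↑) b₀
    obtain ⟨σ, hσ, hσb⟩ := hb'.exists_equiv hM hMsκ B.2
    refine ⟨σ ∘ b₀, EqTpOver.equiv_comp_self σ hσ b₀, ?_⟩
    have := hI.rel_of_fixed hσ h
    rwa [hσb, Subtype.range_coe] at this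
  have hdir : Directed (· ≥ ·) fun B => Filter.principal (G B) := fun B B' =>
    ⟨⟨B ∪ B', mk_union_lt hM.1.le B.2 B'.2⟩,
      Filter.principal_mono.2 fun c hc => ⟨hc.1, hR _ _ _ _ _ hMs hc.2 Set.subset_union_left
        (Set.union_subset_union_right _ Set.subset_union_left) Set.subset_union_left subset_rfl⟩,
      Filter.principal_mono.2 fun c hc => ⟨hc.1, hR _ _ _ _ _ hMs hc.2 Set.subset_union_left
        (Set.union_subset_union_right _ Set.subset_union_right) Set.subset_union_left subset_rfl⟩⟩
  have : Nonempty {B : Set 𝕄 // Cardinal.mk B < κ} := ⟨⟨Ms, hMsκ⟩⟩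
  have : (⨅ B, Filter.principal (G B)).NeBot :=
    Filter.iInf_neBot_of_directed' hdir fun B => Filter.principal_neBot_iff.2 (hne B)
  refine ⟨Ultrafilter.of (⨅ B, Filter.principal (G B)), fun B hB => Ultrafilter.of_le _ ?_⟩
  exact Filter.mem_iInf_of_mem (⟨B, hB⟩ : {B : Set 𝕄 // Cardinal.mk B < κ})
    (Filter.mem_principal_self _)

end Realizations

/-- **Lemma 4.1.** Every type `p(x)` over a small elementary submodel `M` of
`𝕄` has a global extension `q(x)` such that for all tuples `b`, if
`c ⊨ q|_{Mb}` then `b ⫝^CK_M c`.  In particular `q` is a global coheir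
extension of `p` (finitely satisfiable in `M`).  Here `p = tp(b₀/M)`. -/
theorem canonical_coheir_exists (L : FirstOrder.Language.{u, u}) (𝕄 : Type u)
    [L.Structure 𝕄] (κ : Cardinal.{u}) (hmonster : IsMonster L 𝕄 κ)
    (R : IndRel L 𝕄) (hCK : IsCK R κ)
    (Ms : Set 𝕄) (hMs : IsElemSubmodel L Ms) (hMssmall : Cardinal.mk Ms < κ)
    (α : Type u) (hα : Cardinal.mk α < κ) (b₀ : α → 𝕄) :
    ∃ q : GlobalType L 𝕄 α, ExtendsTpOver q Ms b₀ ∧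
      (∀ (β : Type u), Cardinal.mk β < κ → ∀ (b : β → 𝕄) (c : α → 𝕄),
        RealizesType q c (Ms ∪ Set.range b) → R.rel (Set.range b) Ms (Set.range c)) ∧
      q.FinSatInM Ms := by
  obtain ⟨hgood, hweak⟩ := hCK
  obtain ⟨hH, hI, hR, hE, -, -⟩ := id hgood
  obtain ⟨U, hU⟩ := exists_ultrafilter_indepRealizations hmonster hI hR hE hMs hMssmall hα b₀
  refine ⟨GlobalType.ofUltrafilter L U, fun n φ d hd h => ?_, fun β hβ b c hc => ?_,
    fun t ht => ?_⟩
  · exact (hU Ms hMssmall).mono fun c hc' => (hc'.1 n φ d hd).2 h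
  · refine hweak _ (hgood.closure hmonster) _ _ _
      (closure_rel_of_limitIndep hR hMs hMssmall hβ hα ?_ rfl rfl)
    have hcb₀ : EqTpOver L Ms c b₀ := eqTpOver_of_imp fun S hS hcS => by
      obtain ⟨x, hxS, hx⟩ := ((eventually_of_realizesType_ofUltrafilter hc
        (hS.mono Set.subset_union_left) hcS).and (hU Ms hMssmall)).exists
      exact (eqTpOver_iff.1 hx.1 S hS).1 hxS
    intro S hS hbc
    obtain ⟨x, hxS, hx, hbx⟩ := ((eventually_of_realizesType_ofUltrafilter hc
      (definable_section_left hS b Set.subset_union_left fun i => Or.inr ⟨i, rfl⟩) hbc).and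
        (hU _ (mk_range_lt hβ b))).exists
    exact ⟨b, x, EqTpOver.refl _ _, hx.trans hcb₀.symm, hxS, hbx⟩
  · classical
    let B : Set 𝕄 := ⋃ p ∈ t, Set.range p.2.2
    have hB : B.Finite := t.finite_toSet.biUnion fun p _ => Set.finite_range p.2.2
    obtain ⟨c, hct, -, hc⟩ := (((Filter.eventually_all_finset t).2 fun p hp => ht hp).and
      (hU B (hB.lt_aleph0.trans hmonster.1))).exists
    let f (i : α) : ↥(Ms ∪ Set.range c) := ⟨c i, Or.inr ⟨i, rfl⟩⟩
    obtain ⟨S₀, hS₀, hcS₀, hS₀t⟩ := exists_definable_subset_inter (L := L) (C := Ms ∪ (Ms ∪ B)) c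
      (t.image fun p => {x | p.2.1.Realize (Sum.elim x p.2.2)})
    obtain ⟨m, hm, hmS₀⟩ := finSatIn_iff.1 (hH _ _ _ hMs hc) _ (hS₀.preimage_comp f) hcS₀
    refine ⟨m ∘ f, fun i => hm _, fun p hp => ?_⟩
    exact hS₀t _ (Finset.mem_image_of_mem _ hp) (definable_setOf_realize _ _ fun i =>
      Or.inr (Or.inr (Set.mem_biUnion hp ⟨i, rfl⟩))) (hct p hp) hmS₀

end NSOP2Paper
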